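/- Fix real numbers a and b. Then, as the real variable z → ∞, Γ(z + a)/Γ(z + b) = z^{a−b}·(1 + (a−b)(a+b−1)/(2z) + O(z^{−2})); equivalently, the function z ↦ Γ(z+a)/(Γ(z+b)·z^{a−b}) − 1 − (a−b)(a+b−1)/(2z) is O(z^{−2}) as z → ∞. -/

import Mathlib

open Asymptotics Filter

/-- Second-order Taylor expansion of `log (1 + x)` at `0`. -/
lemma isBigO_log_one_add_sub :
    (fun x : ℝ => Real.log (1 + x) - x + x ^ 2 / 2) =O[nhds 0] fun x => x ^ 3 := by
  refine IsBigO.of_bound 2 ?_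
  filter_upwards [Metric.ball_mem_nhds (0 : ℝ) (by norm_num : (0 : ℝ) < 1 / 2)] with x hx
  rw [mem_ball_zero_iff, Real.norm_eq_abs] at hx
  have h := Real.abs_log_sub_add_sum_range_le (x := -x) (by rw [abs_neg]; linarith) 2
  rw [abs_neg] at h
  rw [Real.norm_eq_abs, Real.norm_eq_abs, abs_pow]
  calc |Real.log (1 + x) - x + x ^ 2 / 2|
      = |∑ i ∈ Finset.range 2, (-x) ^ (i + 1) / ((i : ℝ) + 1) + Real.log (1 - -x)| := by
        congr 1
        simp only [Finset.sum_range_succ, Finset.sum_range_zero, sub_neg_eq_add]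
        push_cast
        ring
    _ ≤ |x| ^ 3 / (1 - |x|) := h
    _ ≤ 2 * |x| ^ 3 := by
        rw [div_le_iff₀ (by linarith)]
        nlinarith [pow_nonneg (abs_nonneg x) 3]

/-- A function whose increments are `O(z⁻³)` and which tends to `0` along every arithmetic
progression of step `1` is `O(z⁻²)`. -/
lemma isBigO_inv_sq_of_forward_diff {h : ℝ → ℝ}
    (hd : (fun z => h (z + 1) - h z) =O[atTop] fun z => z⁻¹ ^ 3)
    (hl : ∀ᶠ z in atTop, Tendsto (fun n : ℕ => h (z + n)) atTop (nhds 0)) :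
    h =O[atTop] fun z => z⁻¹ ^ 2 := by
  obtain ⟨C, hC, hb⟩ := hd.exists_pos
  obtain ⟨Z, hZ⟩ := eventually_atTop.1 hb.bound
  refine IsBigO.of_bound (2 * C) ?_
  filter_upwards [eventually_ge_atTop Z, eventually_ge_atTop 1, hl] with z hzZ hz1 hlim
  have step : ∀ w : ℝ, Z ≤ w → 1 ≤ w →
      |h (w + 1) - h w| ≤ 2 * C * (w⁻¹ ^ 2 - (w + 1)⁻¹ ^ 2) := by
    intro w hw hw1
    have h1 := hZ w hw
    have hw0 : 0 < w := by linarith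
    rw [Real.norm_eq_abs, Real.norm_of_nonneg (by positivity)] at h1
    refine h1.trans ?_
    have key : w⁻¹ ^ 3 ≤ 2 * (w⁻¹ ^ 2 - (w + 1)⁻¹ ^ 2) := by
      have : 2 * (w⁻¹ ^ 2 - (w + 1)⁻¹ ^ 2) - w⁻¹ ^ 3
          = (3 * w ^ 2 - 1) / (w ^ 3 * (w + 1) ^ 2) := by
        field_simp
        ring
      have h2 : 0 ≤ (3 * w ^ 2 - 1) / (w ^ 3 * (w + 1) ^ 2) :=
        div_nonneg (by nlinarith) (by positivity)
      linarith
    nlinarith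
  have tele : ∀ n : ℕ, |h (z + n) - h z| ≤ 2 * C * (z⁻¹ ^ 2 - (z + n)⁻¹ ^ 2) := by
    intro n
    induction n with
    | zero => simp
    | succ n ih =>
      have hn : (0 : ℝ) ≤ n := n.cast_nonneg
      have h1 := step (z + n) (by linarith) (by linarith)
      have h2 := abs_sub_le (h (z + n + 1)) (h (z + n)) (h z)
      push_cast
      rw [← add_assoc]
      linarith
  rw [Real.norm_eq_abs, Real.norm_of_nonneg (by positivity)]
  have hlim' : Tendsto (fun n : ℕ => |h (z + n) - h z|) atTop (nhds |h z|) := by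
    simpa using (hlim.sub_const (h z)).abs
  refine le_of_tendsto' hlim' fun n => (tele n).trans ?_
  have : 0 ≤ (z + n)⁻¹ ^ 2 := by positivity
  nlinarith

lemma log_Gamma_add_one {x : ℝ} (hx : 0 < x) :
    Real.log (Real.Gamma (x + 1)) = Real.log (Real.Gamma x) + Real.log x := by
  rw [Real.Gamma_add_one hx.ne', Real.log_mul hx.ne' (Real.Gamma_pos_of_pos hx).ne', add_comm]

lemma tendsto_log_Gamma_add_nat_sub {x : ℝ} (hx : 0 < x) :
    Tendsto (fun n : ℕ => Real.log (Real.Gamma (x + (n + 1 : ℕ))) - x * Real.log n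
      - Real.log n.factorial) atTop (nhds 0) := by
  have h := (Real.BohrMollerup.tendsto_log_gamma hx).const_sub (Real.log (Real.Gamma x))
  rw [sub_self] at h
  refine h.congr fun n => ?_
  rw [Real.BohrMollerup.f_add_nat_eq (f := fun y => Real.log (Real.Gamma y))
    log_Gamma_add_one hx (n + 1), Real.BohrMollerup.logGammaSeq]
  ring

/-- The remainder in the first-order expansion of `log (Γ(z + a) / Γ(z))`. -/
noncomputable def logGammaRem (a z : ℝ) : ℝ :=
  Real.log (Real.Gamma (z + a)) - Real.log (Real.Gamma z) - a * Real.log z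
    - a * (a - 1) / 2 * z⁻¹

lemma tendsto_logGammaRem_add_nat {a z : ℝ} (hz : 0 < z) (hza : 0 < z + a) :
    Tendsto (fun n : ℕ => logGammaRem a (z + n)) atTop (nhds 0) := by
  rw [← tendsto_add_atTop_iff_nat 1]
  have h1 := (tendsto_log_Gamma_add_nat_sub hza).sub (tendsto_log_Gamma_add_nat_sub hz)
  have h2 := ((Real.tendsto_log_comp_add_sub_log (z + 1)).comp
    (tendsto_natCast_atTop_atTop (R := ℝ))).const_mul a
  have h3 : Tendsto (fun n : ℕ => a * (a - 1) / 2 * ((n : ℝ) + (z + 1))⁻¹) atTop (nhds 0) := by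
    simpa using (tendsto_inv_atTop_zero.comp (tendsto_atTop_add_const_right _ (z + 1)
      (tendsto_natCast_atTop_atTop (R := ℝ)))).const_mul (a * (a - 1) / 2)
  have h := (h1.sub h2).sub h3
  simp only [sub_zero, mul_zero] at h
  refine h.congr fun n => ?_
  simp only [logGammaRem, Function.comp_apply]
  have e1 : z + ((n + 1 : ℕ) : ℝ) + a = z + a + ((n + 1 : ℕ) : ℝ) := by ring
  have e2 : (n : ℝ) + (z + 1) = z + ((n + 1 : ℕ) : ℝ) := by push_cast; ring
  rw [e1, e2]
  ring

lemma isBigO_logGammaRem_forward_diff (a : ℝ) :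
    (fun z => logGammaRem a (z + 1) - logGammaRem a z) =O[atTop] fun z => z⁻¹ ^ 3 := by
  have hlog : ∀ c : ℝ, (fun z : ℝ => Real.log (1 + c * z⁻¹) - c * z⁻¹ + (c * z⁻¹) ^ 2 / 2)
      =O[atTop] fun z => z⁻¹ ^ 3 := by
    intro c
    have ht : Tendsto (fun z : ℝ => c * z⁻¹) atTop (nhds 0) := by
      simpa using tendsto_inv_atTop_zero.const_mul c
    refine (isBigO_log_one_add_sub.comp_tendsto ht).trans ?_
    refine IsBigO.of_bound (|c| ^ 3) (Eventually.of_forall fun z => ?_)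
    simp [mul_pow]
  have hinv : (fun z : ℝ => (z ^ 2 * (z + 1))⁻¹) =O[atTop] fun z => z⁻¹ ^ 3 := by
    refine IsBigO.of_bound 1 ?_
    filter_upwards [eventually_gt_atTop 0] with z hz
    rw [Real.norm_of_nonneg (by positivity), Real.norm_of_nonneg (by positivity), one_mul,
      inv_pow]
    gcongr
    nlinarith [sq_nonneg z]
  refine (((hlog a).sub ((hlog 1).const_mul_left a)).sub
    (hinv.const_mul_left (a * (a - 1) / 2))).congr' ?_ EventuallyEq.rfl
  filter_upwards [eventually_gt_atTop 0, eventually_gt_atTop (-a)] with z hz hza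
  have hza' : 0 < z + a := by linarith
  have hl : ∀ c : ℝ, 0 < z + c → Real.log (1 + c * z⁻¹) = Real.log (z + c) - Real.log z := by
    intro c hc
    rw [← Real.log_div hc.ne' hz.ne']
    congr 1
    field_simp
  have e : z + 1 + a = z + a + 1 := by ring
  simp only [logGammaRem]
  rw [hl a hza', hl 1 (by linarith), e, log_Gamma_add_one hza', log_Gamma_add_one hz]
  field_simp
  ring

lemma isBigO_logGammaRem (a : ℝ) : logGammaRem a =O[atTop] fun z => z⁻¹ ^ 2 := by
  refine isBigO_inv_sq_of_forward_diff (isBigO_logGammaRem_forward_diff a) ?_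
  filter_upwards [eventually_gt_atTop 0, eventually_gt_atTop (-a)] with z hz hza
  exact tendsto_logGammaRem_add_nat hz (by linarith)

lemma isBigO_exp_sub_one_sub {u : ℝ → ℝ} {c : ℝ}
    (hu : (fun z => u z - c * z⁻¹) =O[atTop] fun z => z⁻¹ ^ 2) :
    (fun z => Real.exp (u z) - 1 - c * z⁻¹) =O[atTop] fun z => z⁻¹ ^ 2 := by
  have hsq : (fun z : ℝ => z⁻¹ ^ 2) =O[atTop] fun z => z⁻¹ := by
    refine IsBigO.of_bound 1 ?_
    filter_upwards [eventually_ge_atTop 1] with z hz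
    have : z⁻¹ ≤ 1 := inv_le_one_of_one_le₀ hz
    have h0 : 0 ≤ z⁻¹ := by positivity
    rw [Real.norm_of_nonneg (by positivity), Real.norm_of_nonneg h0]
    nlinarith
  have hu1 : u =O[atTop] fun z => z⁻¹ := by
    simpa using (hu.trans hsq).add ((isBigO_refl (fun z : ℝ => z⁻¹) atTop).const_mul_left c)
  have hexp := (Real.exp_sub_sum_range_isBigO_pow 2).comp_tendsto
    (hu1.trans_tendsto tendsto_inv_atTop_zero)
  refine ((hexp.trans (hu1.pow 2)).add hu).congr_left fun z => ?_
  simp [Finset.sum_range_succ]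
  ring

/-- Taylor-type expansion for ratios of Gamma functions: for fixed `a, b ∈ ℝ`, as the
real variable `z → ∞`,
`Γ(z+a)/Γ(z+b) = z^{a−b} (1 + (a−b)(a+b−1)/(2z) + O(z^{−2}))`, i.e. the function
`z ↦ Γ(z+a)/(Γ(z+b) z^{a−b}) − 1 − (a−b)(a+b−1)/(2z)` is `O(z^{−2})`. -/
theorem stmt_15 (a b : ℝ) :
    (fun z : ℝ =>
        Real.Gamma (z + a) / (Real.Gamma (z + b) * z ^ (a - b))
          - 1 - (a - b) * (a + b - 1) / (2 * z))
      =O[atTop] fun z : ℝ => z ^ (-2 : ℝ) := by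
  have hu : (fun z : ℝ => (Real.log (Real.Gamma (z + a)) - Real.log (Real.Gamma (z + b))
      - (a - b) * Real.log z) - (a - b) * (a + b - 1) / 2 * z⁻¹) =O[atTop] fun z => z⁻¹ ^ 2 := by
    refine ((isBigO_logGammaRem a).sub (isBigO_logGammaRem b)).congr_left fun z => ?_
    simp only [logGammaRem]
    ring
  refine (isBigO_exp_sub_one_sub hu).congr' ?_ ?_
  · filter_upwards [eventually_gt_atTop 0, eventually_gt_atTop (-a), eventually_gt_atTop (-b)]
      with z hz hza hzb
    have ha := Real.Gamma_pos_of_pos (by linarith : 0 < z + a)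
    have hb := Real.Gamma_pos_of_pos (by linarith : 0 < z + b)
    rw [Real.exp_sub, Real.exp_sub, Real.exp_log ha, Real.exp_log hb, Real.rpow_def_of_pos hz,
      mul_comm (Real.log z), div_div]
    congr 1
    field_simp
  · filter_upwards [eventually_gt_atTop 0] with z hz
    rw [Real.rpow_neg hz.le, Real.rpow_two, inv_pow]
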